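/- arXiv:2301.10285 — 4 statements merged into one kernel-verified Lean document; each statement's English description precedes it below -/
import Mathlib

section
/- Homogeneous Function Theorem (finite-variable form): Let r be a natural number, let E_1, …, E_r be finite-dimensional real normed vector spaces, let a_1, …, a_r be positive real numbers and w a real number, and let f : E_1 × … × E_r → ℝ be an infinitely differentiable function satisfying f(λ^{a_1}·x_1, …, λ^{a_r}·x_r) = λ^w · f(x_1, …, x_r) for every real λ > 0 and all (x_1,…,x_r). Then there exist a finite set D of tuples d = (d_1,…,d_r) of non-negative integers, each satisfying a_1 d_1 + … + a_r d_r = w, and infinitely differentiable functions g_d : E_1 × … × E_r → ℝ satisfying g_d(c_1·x_1, …, c_r·x_r) = c_1^{d_1} ⋯ c_r^{d_r} · g_d(x_1,…,x_r) for all real scalars c_1,…,c_r and all (x_1,…,x_r), such that f = Σ_{d ∈ D} g_d (i.e., f is a sum of monomials of degree d_i in the variable x_i with a_1 d_1 + … + a_r d_r = w). -/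
open Filter Topology

/-- A smooth function whose `(n + 1)`-st directional derivatives vanish equals its Taylor polynomial
of degree `n` at the origin. -/
theorem eq_sum_iteratedFDeriv_zero_of_iteratedFDeriv_eq_zero {V : Type*} [NormedAddCommGroup V]
    [NormedSpace ℝ V] {f : V → ℝ} (hf : ContDiff ℝ (⊤ : ℕ∞) f) {n : ℕ} (x : V)
    (h : ∀ y, (iteratedFDeriv ℝ (n + 1) f y fun _ => x) = 0) :
    f x = ∑ k ∈ Finset.range (n + 1),
      (k.factorial : ℝ)⁻¹ * iteratedFDeriv ℝ k f 0 fun _ => x := by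
  have hT := map_add_eq_sum_add_integral_iteratedFDeriv (f := f) (n := n) (x := 0) (y := x)
    fun t _ => (hf.of_le (by exact_mod_cast le_top)).contDiffAt
  simpa [h] using hT

section WeightedHomogeneous

variable {r : ℕ} {E : Fin r → Type*} [∀ i, NormedAddCommGroup (E i)] [∀ i, NormedSpace ℝ (E i)]

/-- Iterated partial derivatives of a weighted homogeneous function are weighted homogeneous. -/
theorem iteratedFDeriv_single_of_weighted_homogeneous {a : Fin r → ℝ} {w : ℝ}
    {f : (∀ i, E i) → ℝ} (hf : ContDiff ℝ (⊤ : ℕ∞) f)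
    (hhom : ∀ lam : ℝ, 0 < lam → ∀ x : ∀ i, E i,
      f (fun i => (lam ^ (a i) : ℝ) • x i) = lam ^ w * f x)
    {k : ℕ} (j : Fin k → Fin r) (u x : ∀ i, E i) {lam : ℝ} (hlam : 0 < lam) :
    lam ^ (∑ l, a (j l)) * iteratedFDeriv ℝ k f (fun i => (lam ^ (a i) : ℝ) • x i)
        (fun l => Pi.single (j l) (u (j l))) =
      lam ^ w * iteratedFDeriv ℝ k f x fun l => Pi.single (j l) (u (j l)) := by
  let L : (∀ i, E i) →L[ℝ] (∀ i, E i) :=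
    ContinuousLinearMap.pi fun i => (lam ^ (a i) : ℝ) • ContinuousLinearMap.proj i
  have hL (y : ∀ i, E i) : L y = fun i => (lam ^ (a i) : ℝ) • y i := rfl
  have hLs (i : Fin r) (v : E i) : L (Pi.single i v) = (lam ^ (a i) : ℝ) • Pi.single i v := by
    ext i'
    rcases eq_or_ne i' i with rfl | hne
    · simp [hL]
    · simp [hL, hne]
  have hk : ((k : ℕ∞) : WithTop ℕ∞) ≤ ((⊤ : ℕ∞) : WithTop ℕ∞) := by exact_mod_cast le_top
  have hcomp : f ∘ L = lam ^ w • f := by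
    ext y
    simp [hL, hhom lam hlam]
  have h := L.iteratedFDeriv_comp_right hf x (i := k) hk
  rw [hcomp, iteratedFDeriv_const_smul_apply (hf.of_le hk).contDiffAt] at h
  have h' := congrArg (fun m => m fun l => Pi.single (j l) (u (j l))) h
  simp only [smul_apply,
    ContinuousMultilinearMap.compContinuousLinearMap_apply, hLs,
    ContinuousMultilinearMap.map_smul_univ, smul_eq_mul, hL] at h'
  rw [h', Real.rpow_sum_of_pos hlam]

/-- Iterated partial derivatives of negative weight vanish. -/
theorem iteratedFDeriv_single_eq_zero_of_lt {a : Fin r → ℝ} (ha : ∀ i, 0 < a i) {w : ℝ}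
    {f : (∀ i, E i) → ℝ} (hf : ContDiff ℝ (⊤ : ℕ∞) f)
    (hhom : ∀ lam : ℝ, 0 < lam → ∀ x : ∀ i, E i,
      f (fun i => (lam ^ (a i) : ℝ) • x i) = lam ^ w * f x)
    {k : ℕ} (j : Fin k → Fin r) (hj : w < ∑ l, a (j l)) (u x : ∀ i, E i) :
    (iteratedFDeriv ℝ k f x fun l => Pi.single (j l) (u (j l))) = 0 := by
  have hcont : Continuous fun lam : ℝ => lam ^ (∑ l, a (j l) - w) *
      iteratedFDeriv ℝ k f (fun i => (lam ^ (a i) : ℝ) • x i)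
        fun l => Pi.single (j l) (u (j l)) := by
    refine (Real.continuous_rpow_const (sub_pos.2 hj).le).mul ?_
    have hL : Continuous fun lam : ℝ => fun i => (lam ^ (a i) : ℝ) • x i :=
      continuous_pi fun i => (Real.continuous_rpow_const (ha i).le).smul continuous_const
    have hk : Continuous (iteratedFDeriv ℝ k f) :=
      hf.continuous_iteratedFDeriv (by exact_mod_cast le_top)
    exact (ContinuousMultilinearMap.apply ℝ (fun _ : Fin k => ∀ i, E i) ℝ
      fun l => Pi.single (j l) (u (j l))).continuous.comp (hk.comp hL)
  have hlim := (hcont.tendsto 0).mono_left (nhdsWithin_le_nhds (s := Set.Ioi 0))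
  rw [Real.zero_rpow (sub_pos.2 hj).ne', zero_mul] at hlim
  refine tendsto_nhds_unique (tendsto_const_nhds.congr' ?_) hlim
  filter_upwards [self_mem_nhdsWithin] with lam hlam
  have hlam : 0 < lam := hlam
  rw [Real.rpow_sub hlam, div_mul_eq_mul_div, eq_div_iff (Real.rpow_pos_of_pos hlam w).ne',
    iteratedFDeriv_single_of_weighted_homogeneous hf hhom j u x hlam, mul_comm]

/-- Iterated partial derivatives at the origin of nonzero weight vanish. -/
theorem iteratedFDeriv_zero_single_eq_zero_of_ne {a : Fin r → ℝ} {w : ℝ}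
    {f : (∀ i, E i) → ℝ} (hf : ContDiff ℝ (⊤ : ℕ∞) f)
    (hhom : ∀ lam : ℝ, 0 < lam → ∀ x : ∀ i, E i,
      f (fun i => (lam ^ (a i) : ℝ) • x i) = lam ^ w * f x)
    {k : ℕ} (j : Fin k → Fin r) (hj : ∑ l, a (j l) ≠ w) (u : ∀ i, E i) :
    (iteratedFDeriv ℝ k f 0 fun l => Pi.single (j l) (u (j l))) = 0 := by
  have h := iteratedFDeriv_single_of_weighted_homogeneous hf hhom j u 0 two_pos
  simp only [Pi.zero_apply, smul_zero] at h
  by_contra hne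
  refine hj ?_
  exact (Real.rpow_right_inj two_pos (by norm_num)).1 (mul_right_cancel₀ hne h)

/-- A multilinear map evaluated on a vector of a product space, expanded along the factors. -/
theorem ContinuousMultilinearMap.apply_const_eq_sum_single {k : ℕ}
    (m : ContinuousMultilinearMap ℝ (fun _ : Fin k => ∀ i, E i) ℝ) (x : ∀ i, E i) :
    (m fun _ => x) = ∑ j : Fin k → Fin r, m fun l => Pi.single (j l) (x (j l)) := by
  rw [← m.map_sum (g := fun _ i => Pi.single i (x i))]
  simp only [Finset.univ_sum_single]

/-- The number of times each index occurs in `j`. -/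
def indexMultiplicity {k : ℕ} (j : Fin k → Fin r) (i : Fin r) : ℕ :=
  (Finset.univ.filter fun l => j l = i).card

theorem prod_comp_eq_prod_pow_indexMultiplicity {k : ℕ} (j : Fin k → Fin r) (c : Fin r → ℝ) :
    ∏ l, c (j l) = ∏ i, c i ^ indexMultiplicity j i := by
  rw [← Finset.prod_fiberwise Finset.univ j fun l => c (j l)]
  refine Finset.prod_congr rfl fun i _ => ?_
  rw [Finset.prod_congr rfl fun l hl => by rw [(Finset.mem_filter.1 hl).2], Finset.prod_const]
  rfl

theorem sum_comp_eq_sum_mul_indexMultiplicity {k : ℕ} (j : Fin k → Fin r) (a : Fin r → ℝ) :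
    ∑ l, a (j l) = ∑ i, a i * (indexMultiplicity j i : ℝ) := by
  rw [← Finset.sum_fiberwise Finset.univ j fun l => a (j l)]
  refine Finset.sum_congr rfl fun i _ => ?_
  rw [Finset.sum_congr rfl fun l hl => by rw [(Finset.mem_filter.1 hl).2], Finset.sum_const,
    nsmul_eq_mul, mul_comm]
  rfl

/-- The part of multidegree `d` of a homogeneous polynomial of degree `k` given by `m`. -/
noncomputable def multidegreePart {k : ℕ}
    (m : ContinuousMultilinearMap ℝ (fun _ : Fin k => ∀ i, E i) ℝ) (d : Fin r → ℕ)
    (x : ∀ i, E i) : ℝ :=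
  ∑ j : Fin k → Fin r with indexMultiplicity j = d, m fun l => Pi.single (j l) (x (j l))

theorem contDiff_multidegreePart {k : ℕ}
    (m : ContinuousMultilinearMap ℝ (fun _ : Fin k => ∀ i, E i) ℝ) (d : Fin r → ℕ) :
    ContDiff ℝ (⊤ : ℕ∞) (multidegreePart m d) := by
  refine ContDiff.sum fun j _ => m.contDiff.comp (contDiff_pi.2 fun l => ?_)
  exact ((ContinuousLinearMap.single ℝ E (j l)).comp (ContinuousLinearMap.proj (j l))).contDiff

theorem multidegreePart_smul {k : ℕ}
    (m : ContinuousMultilinearMap ℝ (fun _ : Fin k => ∀ i, E i) ℝ) (d : Fin r → ℕ)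
    (c : Fin r → ℝ) (x : ∀ i, E i) :
    multidegreePart m d (fun i => c i • x i) = (∏ i, c i ^ d i) * multidegreePart m d x := by
  simp only [multidegreePart, Finset.mul_sum]
  refine Finset.sum_congr rfl fun j hj => ?_
  simp only [Pi.single_smul, m.map_smul_univ, smul_eq_mul]
  rw [prod_comp_eq_prod_pow_indexMultiplicity, (Finset.mem_filter.1 hj).2]

end WeightedHomogeneous

/-- **Homogeneous Function Theorem (finite-variable form).**
Let `E 0, …, E (r-1)` be finite-dimensional real normed vector spaces, `a i > 0` real
numbers and `w` a real number, and let `f : (∀ i, E i) → ℝ` be a smooth (`C^∞`) function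
satisfying `f (λ^{a 0} • x 0, …) = λ^w * f x` for every `λ > 0`.  Then `f` is a finite sum
of smooth monomials `g d` of multidegree `d = (d 0, …, d (r-1))`, each satisfying
`∑ i, a i * d i = w`, where being a monomial of multidegree `d` means
`g d (c 0 • x 0, …) = (∏ i, (c i)^(d i)) * g d x` for all real scalars `c i`. -/
theorem homogeneous_function_theorem
    (r : ℕ) (E : Fin r → Type*)
    [∀ i, NormedAddCommGroup (E i)] [∀ i, NormedSpace ℝ (E i)]
    [∀ i, FiniteDimensional ℝ (E i)]
    (a : Fin r → ℝ) (ha : ∀ i, 0 < a i) (w : ℝ)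
    (f : (∀ i, E i) → ℝ) (hf : ContDiff ℝ (⊤ : ℕ∞) f)
    (hhom : ∀ lam : ℝ, 0 < lam → ∀ x : ∀ i, E i,
      f (fun i => (lam ^ (a i) : ℝ) • x i) = lam ^ w * f x) :
    ∃ (D : Finset (Fin r → ℕ)) (g : (Fin r → ℕ) → (∀ i, E i) → ℝ),
      (∀ d ∈ D, ∑ i, a i * (d i : ℝ) = w) ∧
      (∀ d ∈ D, ContDiff ℝ (⊤ : ℕ∞) (g d)) ∧
      (∀ d ∈ D, ∀ (c : Fin r → ℝ) (x : ∀ i, E i),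
        g d (fun i => c i • x i) = (∏ i, (c i) ^ (d i)) * g d x) ∧
      (∀ x : ∀ i, E i, f x = ∑ d ∈ D, g d x) := by
  obtain ⟨ε, hε, hεa⟩ : ∃ ε : ℝ, 0 < ε ∧ ∀ i, ε ≤ a i := by
    rcases isEmpty_or_nonempty (Fin r) with h | h
    · exact ⟨1, one_pos, fun i => h.elim i⟩
    · obtain ⟨i, hi⟩ := Finite.exists_min a
      exact ⟨a i, ha i, hi⟩
  obtain ⟨n, hn⟩ := exists_nat_gt (w / ε)
  have hvanish (y x : ∀ i, E i) : (iteratedFDeriv ℝ (n + 1) f y fun _ => x) = 0 := by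
    rw [ContinuousMultilinearMap.apply_const_eq_sum_single]
    refine Finset.sum_eq_zero fun j _ =>
      iteratedFDeriv_single_eq_zero_of_lt ha hf hhom j ?_ x y
    calc w < n * ε := (div_lt_iff₀ hε).1 hn
      _ ≤ ∑ _l : Fin (n + 1), ε := by simp; nlinarith
      _ ≤ ∑ l, a (j l) := Finset.sum_le_sum fun l _ => hεa (j l)
  let I : Finset (Fin r → ℕ) := (Finset.range (n + 1)).biUnion fun k =>
    Finset.univ.image fun j : Fin k → Fin r => indexMultiplicity j
  refine ⟨I.filter fun d => ∑ i, a i * (d i : ℝ) = w,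
    fun d x => ∑ k ∈ Finset.range (n + 1),
      (k.factorial : ℝ)⁻¹ * multidegreePart (iteratedFDeriv ℝ k f 0) d x,
    fun d hd => (Finset.mem_filter.1 hd).2, fun d _ => ?_, fun d _ c x => ?_, fun x => ?_⟩
  · exact ContDiff.sum fun k _ => contDiff_const.mul (contDiff_multidegreePart _ d)
  · simp only [multidegreePart_smul, Finset.mul_sum]
    exact Finset.sum_congr rfl fun k _ => mul_left_comm _ _ _
  · rw [eq_sum_iteratedFDeriv_zero_of_iteratedFDeriv_eq_zero hf x fun y => hvanish y x,
      Finset.sum_comm]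
    refine Finset.sum_congr rfl fun k hk => ?_
    rw [← Finset.mul_sum, ContinuousMultilinearMap.apply_const_eq_sum_single]
    congr 1
    rw [Finset.sum_filter_of_ne]
    · refine (Finset.sum_fiberwise_of_maps_to (fun j _ => ?_) _).symm
      exact Finset.mem_biUnion.2 ⟨k, hk, Finset.mem_image_of_mem _ (Finset.mem_univ j)⟩
    · intro d _ hd
      by_contra hne
      refine hd (Finset.sum_eq_zero fun j hj => ?_)
      refine iteratedFDeriv_zero_single_eq_zero_of_ne hf hhom j ?_ x
      rwa [sum_comp_eq_sum_mul_indexMultiplicity, (Finset.mem_filter.1 hj).2]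
end

section
/- Homogeneous Function Theorem, vanishing case: Let r be a natural number, let E_1, …, E_r be finite-dimensional real normed vector spaces, let a_1, …, a_r be positive real numbers and w a real number, and let f : E_1 × … × E_r → ℝ be an infinitely differentiable function satisfying f(λ^{a_1}·x_1, …, λ^{a_r}·x_r) = λ^w · f(x_1, …, x_r) for every real λ > 0 and all (x_1,…,x_r). If there exists no tuple (d_1,…,d_r) of non-negative integers with a_1 d_1 + … + a_r d_r = w, then f is identically zero. -/
section WeightedHomogeneous

variable {ι : Type*} {E : ι → Type*}
  [∀ i, NormedAddCommGroup (E i)] [∀ i, NormedSpace ℝ (E i)]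
  {a : ι → ℝ} {w : ℝ} {f : (∀ i, E i) → ℝ}

open Filter Topology

/-- A continuous weighted homogeneous function of negative weight vanishes. -/
theorem eq_zero_of_weightedHomogeneous_of_neg (ha : ∀ i, 0 < a i) (hf : Continuous f)
    (hhom : ∀ lam : ℝ, 0 < lam → ∀ x : ∀ i, E i,
      f (fun i => (lam ^ (a i) : ℝ) • x i) = lam ^ w * f x)
    (hw : w < 0) (x : ∀ i, E i) : f x = 0 := by
  have hcurve : Tendsto (fun lam : ℝ => fun i => (lam ^ (a i) : ℝ) • x i) (𝓝[>] 0) (𝓝 0) := by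
    rw [tendsto_pi_nhds]
    intro i
    have h : Tendsto (fun lam : ℝ => lam ^ a i) (𝓝[>] 0) (𝓝 0) := by
      have h' := (Real.continuousAt_rpow_const 0 (a i) (Or.inr (ha i).le)).tendsto
      rw [Real.zero_rpow (ha i).ne'] at h'
      exact h'.mono_left nhdsWithin_le_nhds
    simpa using h.smul_const (x i)
  have hlim : Tendsto (fun lam : ℝ => lam ^ (-w) * f (fun i => (lam ^ (a i) : ℝ) • x i))
      (𝓝[>] 0) (𝓝 0) := by
    have h := (Real.continuousAt_rpow_const 0 (-w) (Or.inr (neg_pos.2 hw).le)).tendsto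
    rw [Real.zero_rpow (neg_pos.2 hw).ne'] at h
    simpa using (h.mono_left nhdsWithin_le_nhds).mul ((hf.tendsto 0).comp hcurve)
  refine tendsto_nhds_unique (tendsto_const_nhds.congr' ?_) hlim
  filter_upwards [self_mem_nhdsWithin] with lam (hlam : 0 < lam)
  rw [hhom lam hlam, ← mul_assoc, ← Real.rpow_add hlam]
  simp

variable [Fintype ι] [DecidableEq ι]

/-- A partial derivative in the `i`-th variable lowers the weight by `a i`. -/
theorem fderiv_single_weightedHomogeneous (hf : Differentiable ℝ f)
    (hhom : ∀ lam : ℝ, 0 < lam → ∀ x : ∀ i, E i,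
      f (fun i => (lam ^ (a i) : ℝ) • x i) = lam ^ w * f x)
    (i : ι) (v : E i) {lam : ℝ} (hlam : 0 < lam) (x : ∀ i, E i) :
    fderiv ℝ f (fun j => (lam ^ (a j) : ℝ) • x j) (Pi.single i v) =
      lam ^ (w - a i) * fderiv ℝ f x (Pi.single i v) := by
  let L : (∀ i, E i) →L[ℝ] (∀ i, E i) :=
    ContinuousLinearMap.pi fun j => (lam ^ a j : ℝ) • ContinuousLinearMap.proj j
  have hL : L (Pi.single i v) = (lam ^ a i : ℝ) • (Pi.single i v : ∀ i, E i) := by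
    ext j
    rcases eq_or_ne j i with rfl | hj
    · simp [L]
    · simp [L, hj]
  have hcomp : HasFDerivAt (fun y => f (L y)) ((fderiv ℝ f (L x)).comp L) x :=
    (hf (L x)).hasFDerivAt.comp x L.hasFDerivAt
  have hmul : HasFDerivAt (fun y => f (L y)) ((lam ^ w : ℝ) • fderiv ℝ f x) x := by
    have h : (fun y => f (L y)) = fun y => lam ^ w * f y := funext (hhom lam hlam)
    rw [h]
    exact (hf x).hasFDerivAt.const_mul _
  have h := DFunLike.congr_fun (hcomp.unique hmul) (Pi.single i v)
  simp only [ContinuousLinearMap.comp_apply, hL, map_smul, smul_apply,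
    smul_eq_mul] at h
  change fderiv ℝ f (L x) (Pi.single i v) = _
  rw [Real.rpow_sub hlam, div_mul_eq_mul_div, eq_div_iff (Real.rpow_pos_of_pos hlam _).ne', ← h,
    mul_comm]

/-- A smooth weighted homogeneous function vanishes if its weight is not a combination of the
`a i` with coefficients in `ℕ`; the bound `w < n * δ` serves for induction on `n`. -/
theorem eq_zero_of_weightedHomogeneous_of_lt {δ : ℝ} (ha : ∀ i, 0 < a i) (hδ : ∀ i, δ ≤ a i)
    (n : ℕ) (hw : w < n * δ) (hf : ContDiff ℝ (⊤ : ℕ∞) f)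
    (hhom : ∀ lam : ℝ, 0 < lam → ∀ x : ∀ i, E i,
      f (fun i => (lam ^ (a i) : ℝ) • x i) = lam ^ w * f x)
    (hne : ¬ ∃ d : ι → ℕ, ∑ i, a i * (d i : ℝ) = w) (x : ∀ i, E i) : f x = 0 := by
  induction n generalizing w f x with
  | zero =>
    exact eq_zero_of_weightedHomogeneous_of_neg ha hf.continuous hhom (by simpa using hw) x
  | succ n ih =>
    have hdiff : Differentiable ℝ f := hf.differentiable (by simp)
    have hpartial (i : ι) (v : E i) (y : ∀ i, E i) : fderiv ℝ f y (Pi.single i v) = 0 := by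
      refine ih (f := fun y => fderiv ℝ f y (Pi.single i v)) (w := w - a i) ?_ ?_ ?_ ?_ y
      · push_cast at hw
        linarith [hδ i]
      · exact (hf.fderiv_right (by simp)).clm_apply contDiff_const
      · exact fun lam hlam y => fderiv_single_weightedHomogeneous hdiff hhom i v hlam y
      · rintro ⟨d, hd⟩
        refine hne ⟨d + Pi.single i 1, ?_⟩
        simp [mul_add, Finset.sum_add_distrib, hd, Pi.single_apply]
    have hzero (y : ∀ i, E i) : fderiv ℝ f y = 0 := by
      ext v
      rw [← Finset.univ_sum_single v, map_sum]
      simp [hpartial]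
    have hconst := hhom 2 two_pos x
    rw [is_const_of_fderiv_eq_zero hdiff hzero _ x] at hconst
    have hw0 : w ≠ 0 := by
      rintro rfl
      exact hne ⟨0, by simp⟩
    have hpow : (2 : ℝ) ^ w ≠ 1 := by
      rwa [← Real.rpow_zero 2, Ne, Real.rpow_right_inj two_pos (by norm_num)]
    by_contra hx
    exact hpow (mul_right_cancel₀ hx (by rw [← hconst, one_mul]))

end WeightedHomogeneous


/-- **Homogeneous Function Theorem, vanishing case.**
Let `E 0, …, E (r-1)` be finite-dimensional real normed vector spaces, `a i > 0` real
numbers and `w` a real number, and let `f : (∀ i, E i) → ℝ` be a smooth (`C^∞`) function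
satisfying `f (λ^{a 0} • x 0, …) = λ^w * f x` for every `λ > 0`.  If there is no tuple
`d` of non-negative integers with `∑ i, a i * d i = w`, then `f` is identically zero. -/
theorem homogeneous_function_theorem_vanishing
    (r : ℕ) (E : Fin r → Type*)
    [∀ i, NormedAddCommGroup (E i)] [∀ i, NormedSpace ℝ (E i)]
    [∀ i, FiniteDimensional ℝ (E i)]
    (a : Fin r → ℝ) (ha : ∀ i, 0 < a i) (w : ℝ)
    (f : (∀ i, E i) → ℝ) (hf : ContDiff ℝ (⊤ : ℕ∞) f)
    (hhom : ∀ lam : ℝ, 0 < lam → ∀ x : ∀ i, E i,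
      f (fun i => (lam ^ (a i) : ℝ) • x i) = lam ^ w * f x)
    (hne : ¬ ∃ d : Fin r → ℕ, ∑ i, a i * (d i : ℝ) = w) :
    ∀ x : ∀ i, E i, f x = 0 := by
  obtain ⟨δ, hδ0, hδ⟩ : ∃ δ : ℝ, 0 < δ ∧ ∀ i, δ ≤ a i := by
    rcases isEmpty_or_nonempty (Fin r) with _ | _
    · exact ⟨1, one_pos, isEmptyElim⟩
    · obtain ⟨i, hi⟩ := Finite.exists_min a
      exact ⟨a i, ha i, hi⟩
  obtain ⟨n, hn⟩ := exists_nat_gt (w / δ)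
  exact eq_zero_of_weightedHomogeneous_of_lt ha hδ n ((div_lt_iff₀ hδ0).1 hn) hf hhom hne
end

section
/- For every T in N₁ (the space of normal tensors of order 1), the full contraction of T with the inverse symplectic form on the index pairs (1,2) and (3,4) vanishes: Σ_{i,j,k,a = 1}^{2n} Ω^{ij} Ω^{ka} T(e_i, e_j, e_k, e_a) = 0. -/
/-- `V n = ℝ^{2n}`, realized with index set `Fin n ⊕ Fin n` (as in Mathlib's
`Matrix.J` and `Matrix.symplecticGroup`). -/
abbrev V (n : ℕ) : Type := (Fin n ⊕ Fin n) → ℝ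

/-- The inverse symplectic matrix `Ω = J⁻¹`. -/
noncomputable def Om (n : ℕ) : Matrix (Fin n ⊕ Fin n) (Fin n ⊕ Fin n) ℝ :=
  (Matrix.J (Fin n) ℝ)⁻¹

/-- The standard basis vector `e i` of `V n`. -/
def e (n : ℕ) (i : Fin n ⊕ Fin n) : V n := Pi.single i 1

theorem Om_antisymm (n : ℕ) (i j : Fin n ⊕ Fin n) : Om n j i = -Om n i j := by
  have h : (Om n).transpose = -Om n := by
    rw [Om, Matrix.J_inv, Matrix.transpose_neg, Matrix.J_transpose]
  exact congrFun (congrFun h i) j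

/-- If `t` is symmetric in its 2nd and 3rd indices and satisfies the exchange identity of
`N₁`, then its contraction with an antisymmetric `w` on the pairs (1,2) and (3,4) vanishes. -/
theorem antisymm_contraction_eq_zero {ι : Type*} [Fintype ι] (w : ι → ι → ℝ)
    (hw : ∀ i j, w j i = -w i j) (t : ι → ι → ι → ι → ℝ)
    (hsymm : ∀ i j k a, t i j k a = t i k j a)
    (hexch : ∀ i j k a, t i j k a - t k j i a = t i a k j - t k a i j) :
    ∑ i, ∑ j, ∑ k, ∑ a, w i j * w k a * t i j k a = 0 := by
  have hP : ∑ i, ∑ j, ∑ k, ∑ a, w i j * w k a * t k j i a = 0 := by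
    rw [← self_eq_neg]
    conv_lhs => rw [Finset.sum_comm]
    simp only [← Finset.sum_neg_distrib]
    refine Finset.sum_congr rfl fun i _ => Finset.sum_congr rfl fun j _ =>
      Finset.sum_congr rfl fun k _ => Finset.sum_congr rfl fun a _ => ?_
    rw [hw i j, hsymm k i j a]
    ring
  have hQ : ∑ i, ∑ j, ∑ k, ∑ a, w i j * w k a * t i a k j = 0 := by
    refine Finset.sum_eq_zero fun i _ => Finset.sum_eq_zero fun j _ => ?_
    rw [← self_eq_neg]
    conv_lhs => rw [Finset.sum_comm]
    simp only [← Finset.sum_neg_distrib]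
    refine Finset.sum_congr rfl fun k _ => Finset.sum_congr rfl fun a _ => ?_
    rw [hw k a, hsymm i k a j]
    ring
  have hS : ∑ i, ∑ j, ∑ k, ∑ a, w i j * w k a * t k a i j =
      ∑ i, ∑ j, ∑ k, ∑ a, w i j * w k a * t i j k a := by
    simp only [← Fintype.sum_prod_type']
    rw [← Equiv.sum_comp (⟨fun p => (p.2.2.1, p.2.2.2, p.1, p.2.1),
      fun p => (p.2.2.1, p.2.2.2, p.1, p.2.1), fun _ => rfl, fun _ => rfl⟩ :
      ι × ι × ι × ι ≃ ι × ι × ι × ι)]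
    refine Finset.sum_congr rfl fun p _ => ?_
    simp only [Equiv.coe_fn_mk]
    ring
  have hE : ∑ i, ∑ j, ∑ k, ∑ a, (w i j * w k a * t i j k a - w i j * w k a * t k j i a) =
      ∑ i, ∑ j, ∑ k, ∑ a, (w i j * w k a * t i a k j - w i j * w k a * t k a i j) := by
    simp only [← mul_sub, hexch]
  simp only [Finset.sum_sub_distrib] at hE
  linarith

/-- **Vanishing of the `(1,2)(3,4)` contraction on `N₁`.**
For every 4-multilinear form `T` in the space `N₁` of normal tensors of order 1, i.e.
satisfying (i) symmetry in the 2nd and 3rd arguments, (ii) vanishing of the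
symmetrization over the last three arguments, and (iii) the symmetry
`T(x,z,y,w) − T(y,z,x,w) = T(x,w,y,z) − T(y,w,x,z)`, the full contraction of `T` with
`Ω = J⁻¹` on the index pairs `(1,2)` and `(3,4)` vanishes. -/
theorem contraction_vanishes_on_N1 (n : ℕ) (hn : 1 ≤ n)
    (T : MultilinearMap ℝ (fun _ : Fin 4 => V n) ℝ)
    (h1 : ∀ x y z w : V n, T ![x, y, z, w] = T ![x, z, y, w])
    (h2 : ∀ (x : V n) (u : Fin 3 → V n),
      ∑ σ : Equiv.Perm (Fin 3), T ![x, u (σ 0), u (σ 1), u (σ 2)] = 0)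
    (h3 : ∀ x y z w : V n,
      T ![x, z, y, w] - T ![y, z, x, w] = T ![x, w, y, z] - T ![y, w, x, z]) :
    ∑ i, ∑ j, ∑ k, ∑ a,
      Om n i j * Om n k a * T ![e n i, e n j, e n k, e n a] = 0 := by
  exact antisymm_contraction_eq_zero (Om n) (Om_antisymm n)
    (fun i j k a => T ![e n i, e n j, e n k, e n a]) (fun _ _ _ _ => h1 _ _ _ _)
    (fun i j k a => h3 (e n i) (e n k) (e n j) (e n a))
end

section
/- The linear map Φ sending a 4-multilinear form T to the 4-multilinear form Φ(T)(x,y,z,w) := T(x,y,w,z) − T(x,y,z,w) restricts to a linear isomorphism from N₁ onto 𝓡; moreover Φ is equivariant for the action of the symplectic group (in fact of any invertible linear map g) given by (g·T)(x₁,x₂,x₃,x₄) = T(g⁻¹x₁, g⁻¹x₂, g⁻¹x₃, g⁻¹x₄), i.e., Φ(g·T) = g·Φ(T). -/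
/-- The space of 4-multilinear forms on `V n`. -/
abbrev M4 (n : ℕ) := MultilinearMap ℝ (fun _ : Fin 4 => V n) ℝ

/-- Membership in `N₁`, the space of normal tensors of order 1: (i) symmetry in the
2nd and 3rd arguments; (ii) vanishing of the symmetrization over the last three
arguments; (iii) `T(x,z,y,w) − T(y,z,x,w) = T(x,w,y,z) − T(y,w,x,z)`. -/
def IsN1 (n : ℕ) (T : M4 n) : Prop :=
  (∀ x y z w : V n, T ![x, y, z, w] = T ![x, z, y, w]) ∧
  (∀ (x : V n) (u : Fin 3 → V n),
    ∑ σ : Equiv.Perm (Fin 3), T ![x, u (σ 0), u (σ 1), u (σ 2)] = 0) ∧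
  (∀ x y z w : V n,
    T ![x, z, y, w] - T ![y, z, x, w] = T ![x, w, y, z] - T ![y, w, x, z])

/-- Membership in `𝓡`, the space of (symplectic) curvature-like tensors: symmetry in
the first two arguments, antisymmetry in the last two, and the first Bianchi
identity. -/
def IsR (n : ℕ) (R : M4 n) : Prop :=
  (∀ x y z w : V n, R ![x, y, z, w] = R ![y, x, z, w]) ∧
  (∀ x y z w : V n, R ![x, y, z, w] = - R ![x, y, w, z]) ∧
  (∀ x y z w : V n, R ![x, y, z, w] + R ![x, z, w, y] + R ![x, w, y, z] = 0)

/-- The linear map `T ↦ ((x, y, z, w) ↦ T(x, y, w, z) − T(x, y, z, w))`. -/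
def antisymmLastTwo (n : ℕ) : M4 n →ₗ[ℝ] M4 n where
  toFun T := T.domDomCongr (Equiv.swap 2 3) - T
  map_add' _ _ := MultilinearMap.ext fun _ => add_sub_add_comm _ _ _ _
  map_smul' _ _ := MultilinearMap.ext fun _ => (mul_sub _ _ _).symm

/-- The form `(x, y, z, w) ↦ (R(x, y, w, z) + R(x, z, w, y)) / 3`, which recovers a normal
tensor from its associated curvature-like tensor. -/
noncomputable def normalOfCurvature (n : ℕ) (R : M4 n) : M4 n :=
  (1 / 3 : ℝ) • (R.domDomCongr (Equiv.swap 2 3) +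
    R.domDomCongr (Equiv.swap 1 2 * Equiv.swap 2 3))

theorem vec_comp_swap_two_three {α : Type*} (x y z w : α) :
    (fun i => ![x, y, z, w] (Equiv.swap (2 : Fin 4) 3 i)) = ![x, y, w, z] := by
  funext i
  fin_cases i <;> rfl

theorem vec_comp_swap_mul_swap {α : Type*} (x y z w : α) :
    (fun i => ![x, y, z, w] ((Equiv.swap 1 2 * Equiv.swap 2 3 : Equiv.Perm (Fin 4)) i)) =
      ![x, z, w, y] := by
  funext i
  fin_cases i <;> rfl

theorem antisymmLastTwo_apply {n : ℕ} (T : M4 n) (x y z w : V n) :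
    antisymmLastTwo n T ![x, y, z, w] = T ![x, y, w, z] - T ![x, y, z, w] := by
  rw [← vec_comp_swap_two_three x y z w]
  rfl

theorem normalOfCurvature_apply {n : ℕ} (R : M4 n) (x y z w : V n) :
    normalOfCurvature n R ![x, y, z, w] = (R ![x, y, w, z] + R ![x, z, w, y]) / 3 := by
  rw [← vec_comp_swap_two_three x y z w, ← vec_comp_swap_mul_swap x y z w,
    div_eq_inv_mul, ← one_div]
  rfl

theorem M4.ext_vec {n : ℕ} {S T : M4 n}
    (h : ∀ x y z w : V n, S ![x, y, z, w] = T ![x, y, z, w]) : S = T := by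
  refine MultilinearMap.ext fun v => ?_
  have hv : v = ![v 0, v 1, v 2, v 3] := by
    funext i
    fin_cases i <;> rfl
  rw [hv]
  exact h _ _ _ _

theorem sum_perm_fin_three (f : Fin 3 → Fin 3 → Fin 3 → ℝ) :
    ∑ σ : Equiv.Perm (Fin 3), f (σ 0) (σ 1) (σ 2) =
      f 0 1 2 + f 0 2 1 + f 1 0 2 + f 1 2 0 + f 2 0 1 + f 2 1 0 := by
  have h : (Finset.univ : Finset (Equiv.Perm (Fin 3))) =
      {1, Equiv.swap 1 2, Equiv.swap 0 1, Equiv.swap 0 1 * Equiv.swap 1 2,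
        Equiv.swap 1 2 * Equiv.swap 0 1, Equiv.swap 0 2} := by decide
  rw [h, Finset.sum_insert (by decide), Finset.sum_insert (by decide),
    Finset.sum_insert (by decide), Finset.sum_insert (by decide),
    Finset.sum_insert (by decide), Finset.sum_singleton]
  simp only [← add_assoc]
  rfl

theorem IsN1.cyclic_sum {n : ℕ} {T : M4 n} (hT : IsN1 n T) (x y z w : V n) :
    T ![x, y, z, w] + T ![x, z, w, y] + T ![x, w, y, z] = 0 := by
  have h := hT.2.1 x ![y, z, w]
  rw [sum_perm_fin_three fun i j k =>
    T ![x, ![y, z, w] i, ![y, z, w] j, ![y, z, w] k]] at h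
  simp only [Matrix.cons_val] at h
  linarith [hT.1 x y z w, hT.1 x z w y, hT.1 x w y z]

theorem IsN1.isR_antisymmLastTwo {n : ℕ} {T : M4 n} (hT : IsN1 n T) :
    IsR n (antisymmLastTwo n T) := by
  refine ⟨fun x y z w => ?_, fun x y z w => ?_, fun x y z w => ?_⟩ <;>
    simp only [antisymmLastTwo_apply]
  · linarith [hT.2.2 x y z w, hT.1 x z y w, hT.1 y z x w, hT.1 x w y z, hT.1 y w x z]
  · ring
  · linarith [hT.1 x y z w, hT.1 x z w y, hT.1 x w y z]

theorem IsR.isN1_normalOfCurvature {n : ℕ} {R : M4 n} (hR : IsR n R) :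
    IsN1 n (normalOfCurvature n R) := by
  obtain ⟨hsymm, hanti, hbianchi⟩ := hR
  refine ⟨fun x y z w => ?_, fun x u => ?_, fun x y z w => ?_⟩
  · simp only [normalOfCurvature_apply]
    ring
  · rw [sum_perm_fin_three fun i j k => normalOfCurvature n R ![x, u i, u j, u k]]
    simp only [normalOfCurvature_apply]
    linarith [hanti x (u 0) (u 1) (u 2), hanti x (u 1) (u 0) (u 2), hanti x (u 2) (u 0) (u 1)]
  · simp only [normalOfCurvature_apply]
    linarith [hbianchi x y z w, hbianchi y x z w, hsymm x y z w, hsymm x y w z,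
      hanti x y z w, hanti y x z w, hanti x z w y, hanti x w y z, hanti y z w x,
      hanti y w x z]

theorem IsR.antisymmLastTwo_normalOfCurvature {n : ℕ} {R : M4 n} (hR : IsR n R) :
    antisymmLastTwo n (normalOfCurvature n R) = R := by
  refine M4.ext_vec fun x y z w => ?_
  simp only [antisymmLastTwo_apply, normalOfCurvature_apply]
  linarith [hR.2.2 x y z w, hR.2.1 x y z w, hR.2.1 x z w y, hR.2.1 x w y z]

theorem IsN1.normalOfCurvature_antisymmLastTwo {n : ℕ} {T : M4 n} (hT : IsN1 n T) :
    normalOfCurvature n (antisymmLastTwo n T) = T := by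
  refine M4.ext_vec fun x y z w => ?_
  simp only [normalOfCurvature_apply, antisymmLastTwo_apply]
  linarith [hT.cyclic_sum x y z w, hT.1 x y z w, hT.1 x z w y, hT.1 x w y z]

/-- **The map `Φ(T)(x,y,z,w) = T(x,y,w,z) − T(x,y,z,w)` is a linear isomorphism from
`N₁` onto `𝓡`, equivariant under every invertible linear map `g` acting by
`(g·T)(x₁,…,x₄) = T(g⁻¹x₁,…,g⁻¹x₄)`.**  Linearity, the formula, mapping `N₁` into
`𝓡`, bijectivity from `N₁` onto `𝓡`, and equivariance are asserted. -/
theorem N1_equiv_R (n : ℕ) (hn : 1 ≤ n) :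
    ∃ Φ : M4 n →ₗ[ℝ] M4 n,
      (∀ (T : M4 n) (x y z w : V n),
        Φ T ![x, y, z, w] = T ![x, y, w, z] - T ![x, y, z, w]) ∧
      (∀ T : M4 n, IsN1 n T → IsR n (Φ T)) ∧
      (∀ R : M4 n, IsR n R → ∃! T : M4 n, IsN1 n T ∧ Φ T = R) ∧
      (∀ (g : V n ≃ₗ[ℝ] V n) (T : M4 n),
        Φ (T.compLinearMap fun _ => g.symm.toLinearMap)
          = (Φ T).compLinearMap fun _ => g.symm.toLinearMap) := by
  refine ⟨antisymmLastTwo n, antisymmLastTwo_apply, fun T hT => hT.isR_antisymmLastTwo,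
    fun R hR => ⟨normalOfCurvature n R,
      ⟨hR.isN1_normalOfCurvature, hR.antisymmLastTwo_normalOfCurvature⟩, ?_⟩,
    fun g T => rfl⟩
  rintro T ⟨hT, rfl⟩
  exact hT.normalOfCurvature_antisymmLastTwo.symm
end
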